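/- For every C₀ > 0 there exists a constant C depending only on C₀ such that for every s ∈ (1/2,1) the following holds. Let L ∈ (0, C₀] and let γ₀ be a closed simple arc-length curve on S² of length L with unit normal ν(t) := γ₀(t) × γ₀'(t), satisfying ∫_0^L ∫_0^L |ν(t)−ν(t̄)|² k_s(γ₀(t), γ₀(t̄)) dt dt̄ ≤ C₀ L. Then there exists e ∈ S² such that |ν(t) − e| ≤ C (1−s)^{1/2} for all t, and |ν(t) − ν(t̄)| ≤ C (1−s)^{1/2} |t−t̄|^{1/4} for all t, t̄ ∈ [0,L]. Moreover, for every ε > 0 there exists s_* ∈ (1/2,1), depending only on C₀ and ε, such that if in addition s ∈ (s_*,1) then |L − 2π| ≤ ε. -/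

import Mathlib

open MeasureTheory
open scoped ENNReal RealInnerProductSpace

noncomputable section

abbrev E3 := EuclideanSpace ℝ (Fin 3)

/-- Cross product in `ℝ³` (Euclidean). -/
def cross (a b : E3) : E3 :=
  (WithLp.equiv 2 (Fin 3 → ℝ)).symm
    ![a 1 * b 2 - a 2 * b 1, a 2 * b 0 - a 0 * b 2, a 0 * b 1 - a 1 * b 0]

/-- The kernel `k_s(x̂,ŷ) = ∫_0^∞ t (t² + 1 − 2t x̂·ŷ)^{−(3+s)/2} dt ∈ [0,∞]`. -/
def kernelK (s : ℝ) (x y : E3) : ℝ≥0∞ :=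
  ∫⁻ t in Set.Ioi (0:ℝ), ENNReal.ofReal (t * (t ^ 2 + 1 - 2 * t * ⟪x, y⟫) ^ (-(3 + s)/2))

/-- The unit normal `ν(t) = γ₀(t) × γ₀'(t)` of an arc-length curve on `S²`. -/
def nu (γ₀ : ℝ → E3) (t : ℝ) : E3 := cross (γ₀ t) (deriv γ₀ t)

/-- The hypotheses of STATEMENT 16 on the curve `γ₀`: a closed simple arc-length curve on
`S²` of length `L ∈ (0,C₀]` with integrally controlled squared nonlocal second
fundamental form. -/
def CurveHyp (C₀ s L : ℝ) (γ₀ : ℝ → E3) : Prop :=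
  0 < L ∧ L ≤ C₀ ∧ ContDiff ℝ 2 γ₀ ∧ Function.Periodic γ₀ L ∧
  (∀ t, ‖γ₀ t‖ = 1) ∧ (∀ t, ‖deriv γ₀ t‖ = 1) ∧ Set.InjOn γ₀ (Set.Ico 0 L) ∧
  (∫⁻ t in Set.Icc (0:ℝ) L, ∫⁻ u in Set.Icc (0:ℝ) L,
      ENNReal.ofReal (‖nu γ₀ t - nu γ₀ u‖ ^ 2) * kernelK s (γ₀ t) (γ₀ u))
    ≤ ENNReal.ofReal (C₀ * L)

lemma kernel_lower_aux (s : ℝ) (hs : s ∈ Set.Ioo (1/2 : ℝ) 1) (x y : E3) (hx : ‖x‖ = 1)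
    (hy : ‖y‖ = 1) (h : ℝ) (h0 : 0 < h) (h2 : h ≤ 2) (hd : ‖x - y‖ ≤ h) :
    ENNReal.ofReal (h ^ (-2 - s) / 16) ≤ kernelK s x y := by
  obtain ⟨hs1, hs2⟩ := hs
  have hin : ‖x - y‖ ^ 2 = 2 - 2 * ⟪x, y⟫ := by
    rw [@norm_sub_sq_real, hx, hy]; ring
  have hpt : ∀ t ∈ Set.Ioc (1:ℝ) (1 + h), (2 * h) ^ (-(3 + s)) ≤
      t * (t ^ 2 + 1 - 2 * t * ⟪x, y⟫) ^ (-(3 + s)/2) := by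
    intro t ht
    obtain ⟨ht1, ht2⟩ := ht
    have hE : t ^ 2 + 1 - 2 * t * ⟪x, y⟫ = (t - 1) ^ 2 + t * ‖x - y‖ ^ 2 := by
      rw [hin]; ring
    have hpos : 0 < t ^ 2 + 1 - 2 * t * ⟪x, y⟫ := by
      rw [hE]
      have : 0 < (t - 1) ^ 2 := by apply pow_pos; linarith
      have : 0 ≤ t * ‖x - y‖ ^ 2 := by positivity
      linarith
    have hle : t ^ 2 + 1 - 2 * t * ⟪x, y⟫ ≤ (2 * h) ^ 2 := by
      rw [hE]
      have h3 : ‖x - y‖ ^ 2 ≤ h ^ 2 := by gcongr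
      have h4 : (t - 1) ^ 2 ≤ h ^ 2 := by (gcongr; linarith)
      have h5 : t * ‖x - y‖ ^ 2 ≤ 3 * h ^ 2 := by
        apply mul_le_mul _ h3 (by positivity) (by norm_num)
        linarith
      nlinarith
    have h6 : ((2 * h) ^ 2) ^ (-(3 + s)/2) ≤ (t ^ 2 + 1 - 2 * t * ⟪x, y⟫) ^ (-(3 + s)/2) :=
      Real.rpow_le_rpow_of_nonpos hpos hle (by linarith)
    have h7 : ((2 * h) ^ 2) ^ (-(3 + s)/2) = (2 * h) ^ (-(3 + s)) := by
      rw [← Real.rpow_natCast, ← Real.rpow_mul (by positivity)]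
      congr 1; push_cast; ring
    rw [h7] at h6
    have h8 : 0 ≤ (t ^ 2 + 1 - 2 * t * ⟪x, y⟫) ^ (-(3 + s)/2) := Real.rpow_nonneg hpos.le _
    nlinarith
  have hval : h ^ (-2 - s) / 16 ≤ (2 * h) ^ (-(3 + s)) * h := by
    rw [Real.mul_rpow (by norm_num) h0.le]
    have h9 : h ^ (-2 - s) = h ^ (-(3 + s)) * h := by
      rw [show -2 - s = -(3 + s) + 1 by ring, Real.rpow_add h0, Real.rpow_one]
    have h10 : (1/16 : ℝ) ≤ 2 ^ (-(3 + s)) := by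
      have : (1/16 : ℝ) = 2 ^ (-4 : ℝ) := by
        rw [Real.rpow_neg (by norm_num)]; norm_num
      rw [this]
      apply Real.rpow_le_rpow_of_exponent_le (by norm_num); linarith
    rw [h9]
    have : 0 ≤ h ^ (-(3 + s)) * h := by positivity
    nlinarith
  calc ENNReal.ofReal (h ^ (-2 - s) / 16) ≤ ENNReal.ofReal ((2 * h) ^ (-(3 + s)) * h) :=
        ENNReal.ofReal_le_ofReal hval
    _ = ∫⁻ t in Set.Ioc (1:ℝ) (1 + h), ENNReal.ofReal ((2 * h) ^ (-(3 + s))) := by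
        rw [setLIntegral_const, Real.volume_Ioc, ENNReal.ofReal_mul (by positivity)]
        congr 2; ring
    _ ≤ ∫⁻ t in Set.Ioc (1:ℝ) (1 + h),
        ENNReal.ofReal (t * (t ^ 2 + 1 - 2 * t * ⟪x, y⟫) ^ (-(3 + s)/2)) := by
        apply setLIntegral_mono' measurableSet_Ioc
        intro t ht
        exact ENNReal.ofReal_le_ofReal (hpt t ht)
    _ ≤ kernelK s x y := by
        apply lintegral_mono_set
        intro t ht
        exact lt_trans one_pos ht.1

lemma kernel_lower (s : ℝ) (hs : s ∈ Set.Ioo (1/2 : ℝ) 1) (x y : E3) (hx : ‖x‖ = 1)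
    (hy : ‖y‖ = 1) (h : ℝ) (h0 : 0 < h) (hd : ‖x - y‖ ≤ h) :
    ENNReal.ofReal (h ^ (-2 - s) / 16) ≤ kernelK s x y := by
  rcases le_total h 2 with h2 | h2
  · exact kernel_lower_aux s hs x y hx hy h h0 h2 hd
  · refine le_trans ?_ (kernel_lower_aux s hs x y hx hy 2 (by norm_num) le_rfl ?_)
    · apply ENNReal.ofReal_le_ofReal
      have := Real.rpow_le_rpow_of_nonpos (by norm_num : (0:ℝ) < 2) h2
        (by linarith [hs.1] : -2 - s ≤ 0)
      linarith
    · calc ‖x - y‖ ≤ ‖x‖ + ‖y‖ := norm_sub_le _ _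
        _ = 2 := by rw [hx, hy]; norm_num

lemma inner_E3 (a b : E3) : ⟪a, b⟫ = a 0 * b 0 + a 1 * b 1 + a 2 * b 2 := by
  simp [PiLp.inner_apply, Fin.sum_univ_three]; ring

lemma inner_cross_cross (a b c d : E3) :
    ⟪cross a b, cross c d⟫ = ⟪a, c⟫ * ⟪b, d⟫ - ⟪a, d⟫ * ⟪b, c⟫ := by
  simp only [inner_E3]; simp [cross]; ring

lemma inner_cross_self (a b : E3) : ⟪a, cross a b⟫ = 0 := by
  simp only [inner_E3]; simp [cross]; ring

lemma continuous_cross : Continuous (fun p : E3 × E3 => cross p.1 p.2) := by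
  unfold cross
  apply (PiLp.continuous_toLp 2 _).comp
  fun_prop

lemma inner_deriv_zero (γ : ℝ → E3) (hd : Differentiable ℝ γ) (h1 : ∀ t, ‖γ t‖ = 1) (t : ℝ) :
    ⟪γ t, deriv γ t⟫ = 0 := by
  have h := (hd t).hasDerivAt
  have h2 := h.inner ℝ h
  have h3 : (fun t => ⟪γ t, γ t⟫) = fun _ => (1:ℝ) := by
    ext t; rw [real_inner_self_eq_norm_sq, h1]; norm_num
  rw [h3] at h2
  have := h2.unique (hasDerivAt_const t (1:ℝ))
  rw [real_inner_comm] at this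
  linarith [real_inner_comm (deriv γ t) (γ t)]

lemma norm_nu (γ : ℝ → E3) (hd : Differentiable ℝ γ) (h1 : ∀ t, ‖γ t‖ = 1)
    (h2 : ∀ t, ‖deriv γ t‖ = 1) (t : ℝ) : ‖nu γ t‖ = 1 := by
  have : ‖nu γ t‖ ^ 2 = 1 := by
    rw [← real_inner_self_eq_norm_sq, nu, inner_cross_cross, real_inner_self_eq_norm_sq,
      real_inner_self_eq_norm_sq, h1, h2, inner_deriv_zero γ hd h1]; norm_num
  nlinarith [norm_nonneg (nu γ t)]

lemma periodic_deriv {γ : ℝ → E3} {L : ℝ} (hp : Function.Periodic γ L) :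
    Function.Periodic (deriv γ) L := by
  intro t
  have : (fun x => γ (x + L)) = γ := funext hp
  rw [← deriv_comp_add_const, this]

lemma periodic_nu {γ : ℝ → E3} {L : ℝ} (hp : Function.Periodic γ L) :
    Function.Periodic (nu γ) L := by
  intro t
  simp [nu, hp t, periodic_deriv hp t]

lemma continuous_nu {γ : ℝ → E3} (hc : ContDiff ℝ 2 γ) : Continuous (nu γ) := by
  have h1 : Continuous γ := hc.continuous
  have h2 : Continuous (deriv γ) := hc.continuous_deriv (by norm_num)
  exact continuous_cross.comp (h1.prodMk h2)

lemma norm_curve_sub {γ : ℝ → E3} (hd : Differentiable ℝ γ) (h2 : ∀ t, ‖deriv γ t‖ = 1)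
    (a b : ℝ) : ‖γ a - γ b‖ ≤ |a - b| := by
  have := Convex.norm_image_sub_le_of_norm_deriv_le (f := γ) (s := Set.univ) (C := 1)
    (fun x _ => hd x) (fun x _ => (h2 x).le) convex_univ (Set.mem_univ b) (Set.mem_univ a)
  simpa using this

lemma cs_bound (g : ℝ → E3) (hg : Continuous g) (a r B : ℝ) (hr : 0 < r) (hB : 0 < B)
    (h : ∫ u in a..(a + r), ‖g u‖ ^ 2 ≤ B ^ 2 * r ^ (3/2 : ℝ)) :
    ‖∫ u in a..(a + r), g u‖ ≤ B * r ^ (1/4 : ℝ) * r := by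
  have hle : a ≤ a + r := by linarith
  set l : ℝ := B * r ^ (1/4 : ℝ) with hl
  have hl0 : 0 < l := by positivity
  have hl2 : B ^ 2 * r ^ (3/2 : ℝ) = l ^ 2 * r := by
    rw [hl, mul_pow, ← Real.rpow_natCast (r ^ (1/4 : ℝ)), ← Real.rpow_mul hr.le, mul_assoc,
      ← Real.rpow_add_one hr.ne']
    norm_num
  calc ‖∫ u in a..(a + r), g u‖ ≤ ∫ u in a..(a + r), ‖g u‖ :=
        intervalIntegral.norm_integral_le_integral_norm hle
    _ ≤ ∫ u in a..(a + r), (l / 2 + (2 * l)⁻¹ * ‖g u‖ ^ 2) := by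
        apply intervalIntegral.integral_mono_on hle
        · exact hg.norm.intervalIntegrable _ _
        · exact Continuous.intervalIntegrable (by fun_prop) _ _
        · intro u _
          have : l / 2 + (2 * l)⁻¹ * ‖g u‖ ^ 2 - ‖g u‖ = (2 * l)⁻¹ * (l - ‖g u‖) ^ 2 := by
            field_simp; ring
          have h2 : 0 ≤ (2 * l)⁻¹ * (l - ‖g u‖) ^ 2 := by positivity
          linarith
    _ = r * (l / 2) + (2 * l)⁻¹ * ∫ u in a..(a + r), ‖g u‖ ^ 2 := by
        rw [intervalIntegral.integral_add (by simp)
          (Continuous.intervalIntegrable (by fun_prop) _ _),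
          intervalIntegral.integral_const_mul, intervalIntegral.integral_const]
        simp
    _ ≤ r * (l / 2) + (2 * l)⁻¹ * (l ^ 2 * r) := by
        rw [← hl2]; gcongr
    _ = l * r := by field_simp; ring

lemma morrey (f : ℝ → E3) (hf : Continuous f) (L B : ℝ) (hB : 0 < B)
    (hΩ : ∀ x h, 0 < h → h ≤ L → ∫ u in x..(x + h), ‖f (u + h) - f u‖ ^ 2 ≤ B ^ 2 * h ^ (3/2 : ℝ))
    (x h : ℝ) (h0 : 0 < h) (hL : h ≤ L) : ‖f (x + h) - f x‖ ≤ 9 * B * h ^ (1/4 : ℝ) := by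
  have hii : ∀ a b, IntervalIntegrable f volume a b := fun a b => hf.intervalIntegrable a b
  have hii2 : ∀ r a b, IntervalIntegrable (fun u => f (u + r)) volume a b := fun r a b =>
    Continuous.intervalIntegrable (by fun_prop) a b
  set F : ℝ → ℝ → E3 := fun r x => r⁻¹ • ∫ u in x..(x + r), f u with hF
  have hshift : ∀ r x, 0 < r → r ≤ L →
      ‖∫ u in x..(x + r), (f (u + r) - f u)‖ ≤ B * r ^ (1/4 : ℝ) * r := fun r x hr hrL =>
    cs_bound _ (by fun_prop) x r B hr hB (hΩ x r hr hrL)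
  have hshift' : ∀ r x, ∫ u in x..(x + r), (f (u + r) - f u) =
      (∫ u in (x + r)..(x + r + r), f u) - ∫ u in x..(x + r), f u := by
    intro r x
    rw [intervalIntegral.integral_sub (hii2 r _ _) (hii _ _),
      intervalIntegral.integral_comp_add_right]
  have hstep : ∀ r x, 0 < r → r ≤ L → ‖F (2 * r) x - F r x‖ ≤ B / 2 * r ^ (1/4 : ℝ) := by
    intro r x hr hrL
    have e1 : F (2 * r) x - F r x = (2 * r)⁻¹ • ∫ u in x..(x + r), (f (u + r) - f u) := by
      rw [hshift']
      simp only [hF]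
      rw [show x + 2 * r = x + r + r by ring,
        ← intervalIntegral.integral_add_adjacent_intervals (hii x (x + r)) (hii _ (x + r + r))]
      have : r⁻¹ = (2 * r)⁻¹ + (2 * r)⁻¹ := by field_simp; norm_num
      rw [this]
      module
    rw [e1, norm_smul, Real.norm_of_nonneg (by positivity)]
    calc (2 * r)⁻¹ * ‖∫ u in x..(x + r), (f (u + r) - f u)‖
        ≤ (2 * r)⁻¹ * (B * r ^ (1/4 : ℝ) * r) := by gcongr; exact hshift r x hr hrL
      _ = B / 2 * r ^ (1/4 : ℝ) := by field_simp
  set q : ℝ := (1/2 : ℝ) ^ (1/4 : ℝ) with hq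
  have hq0 : 0 < q := by positivity
  have hq89 : q ≤ 8 / 9 := by
    have h4 : q ^ 4 = 1 / 2 := by
      rw [hq, ← Real.rpow_natCast, ← Real.rpow_mul (by norm_num)]; norm_num
    by_contra hc
    push Not at hc
    have : (8/9 : ℝ) ^ 4 < q ^ 4 := by gcongr
    rw [h4] at this; norm_num at this
  have hiter : ∀ x, ∀ n : ℕ, ‖F h x - F (h * (1/2) ^ n) x‖ ≤
      4 * B * h ^ (1/4 : ℝ) * (1 - q ^ n) := by
    intro x n
    induction n with
    | zero => simp
    | succ n ih =>
      have hr : 0 < h * (1/2 : ℝ) ^ (n + 1) := by positivity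
      have hrL : h * (1/2 : ℝ) ^ (n + 1) ≤ L := by
        have : (1/2 : ℝ) ^ (n + 1) ≤ 1 := pow_le_one₀ (by norm_num) (by norm_num)
        nlinarith
      have h1 := hstep _ x hr hrL
      rw [show 2 * (h * (1/2 : ℝ) ^ (n + 1)) = h * (1/2) ^ n by ring] at h1
      have h2 : (h * (1/2 : ℝ) ^ (n + 1)) ^ (1/4 : ℝ) = h ^ (1/4 : ℝ) * q ^ (n + 1) := by
        rw [Real.mul_rpow h0.le (by positivity), hq, ← Real.rpow_natCast, ← Real.rpow_natCast,
          ← Real.rpow_mul (by norm_num), ← Real.rpow_mul (by norm_num), mul_comm (1/4 : ℝ)]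
      rw [h2] at h1
      have h3 : 0 ≤ B * h ^ (1/4 : ℝ) * q ^ n := by positivity
      calc ‖F h x - F (h * (1/2) ^ (n + 1)) x‖ ≤ ‖F h x - F (h * (1/2) ^ n) x‖ +
          ‖F (h * (1/2) ^ n) x - F (h * (1/2) ^ (n + 1)) x‖ := norm_sub_le_norm_sub_add_norm_sub ..
        _ ≤ 4 * B * h ^ (1/4 : ℝ) * (1 - q ^ n) + B / 2 * (h ^ (1/4 : ℝ) * q ^ (n + 1)) := by
          gcongr
        _ ≤ _ := by
          rw [pow_succ]
          nlinarith [mul_nonneg h3 (sub_nonneg.2 hq89)]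
  have hlim : ∀ x, Filter.Tendsto (fun n : ℕ => F (h * (1/2) ^ n) x) Filter.atTop
      (nhds (f x)) := by
    intro x
    have hd := intervalIntegral.integral_hasDerivAt_right (hii x x)
      (hf.stronglyMeasurableAtFilter _ _) hf.continuousAt
    have ht := hd.tendsto_slope_zero_right
    simp only [intervalIntegral.integral_same, sub_zero] at ht
    refine ht.comp (tendsto_nhdsWithin_iff.2 ⟨?_, ?_⟩)
    · have := (tendsto_pow_atTop_nhds_zero_of_lt_one (r := (1/2 : ℝ)) (by norm_num)
        (by norm_num)).const_mul h
      simpa using this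
    · exact Filter.Eventually.of_forall fun n => by
        simp only [Set.mem_Ioi]; positivity
  have hclose : ∀ x, ‖F h x - f x‖ ≤ 4 * B * h ^ (1/4 : ℝ) := by
    intro x
    refine le_of_tendsto ((tendsto_const_nhds.sub (hlim x)).norm) (Filter.Eventually.of_forall ?_)
    intro n
    refine (hiter x n).trans ?_
    have : 0 ≤ 4 * B * h ^ (1/4 : ℝ) * q ^ n := by positivity
    linarith
  have hmid : ‖F h (x + h) - F h x‖ ≤ B * h ^ (1/4 : ℝ) := by
    have e1 : F h (x + h) - F h x = h⁻¹ • ∫ u in x..(x + h), (f (u + h) - f u) := by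
      rw [hshift']; simp only [hF]; module
    rw [e1, norm_smul, Real.norm_of_nonneg (by positivity)]
    calc h⁻¹ * ‖∫ u in x..(x + h), (f (u + h) - f u)‖
        ≤ h⁻¹ * (B * h ^ (1/4 : ℝ) * h) := by gcongr; exact hshift h x h0 hL
      _ = B * h ^ (1/4 : ℝ) := by field_simp
  have h1 := hclose (x + h)
  have h2 := hclose x
  have e : f (x + h) - f x = -(F h (x + h) - f (x + h)) + (F h (x + h) - F h x) +
    (F h x - f x) := by abel
  rw [e]
  refine (norm_add₃_le).trans ?_
  rw [norm_neg]
  linarith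

lemma omega_abstract (Ω : ℝ → ℝ) (hc : Continuous Ω) (hnn : ∀ h, 0 ≤ Ω h)
    (hsub : ∀ h k, Ω (h + k) ≤ 2 * Ω h + 2 * Ω k) (s L E : ℝ) (hs : s ∈ Set.Ioo (1/2 : ℝ) 1)
    (hE : 0 ≤ E)
    (hen : ∫⁻ h in Set.Ioc 0 L, ENNReal.ofReal (Ω h * h ^ (-2 - s)) ≤ ENNReal.ofReal E)
    (h : ℝ) (h0 : 0 < h) (hL : h ≤ L) : Ω h ≤ 8 * (1 - s) * E * h ^ (1 + s) := by
  obtain ⟨hs1, hs2⟩ := hs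
  set φ : ℝ → ℝ := fun h => Ω h * h ^ (-2 - s) with hφ
  have hφnn : ∀ h, 0 ≤ h → 0 ≤ φ h := fun h hh => mul_nonneg (hnn h) (Real.rpow_nonneg hh _)
  have hae : 0 ≤ᵐ[volume.restrict (Set.Ioc 0 L)] φ := by
    filter_upwards [ae_restrict_mem measurableSet_Ioc] with x hx using hφnn x hx.1.le
  have hmeas : AEStronglyMeasurable φ (volume.restrict (Set.Ioc 0 L)) := by
    apply Measurable.aestronglyMeasurable
    have := hc.measurable
    fun_prop
  have hφint : IntegrableOn φ (Set.Ioc 0 L) := by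
    refine ⟨hmeas, ?_⟩
    rw [hasFiniteIntegral_iff_ofReal hae]
    exact hen.trans_lt ENNReal.ofReal_lt_top
  have hJL : ∫ x in Set.Ioc 0 L, φ x ≤ E := by
    rw [integral_eq_lintegral_of_nonneg_ae hae hmeas]
    exact ENNReal.toReal_le_of_le_ofReal hE hen
  set H : ℝ := 2 * h / 3 with hH
  have H0 : 0 < H := by positivity
  have HL : H ≤ L := by linarith
  have hii : ∀ a b, 0 ≤ a → a ≤ b → b ≤ L → IntervalIntegrable φ volume a b := by
    intro a b ha hab hb
    rw [intervalIntegrable_iff_integrableOn_Ioc_of_le hab]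
    exact hφint.mono_set (Set.Ioc_subset_Ioc ha hb)
  have hJ : ∫ x in (0:ℝ)..H, φ x ≤ E := by
    refine le_trans ?_ hJL
    rw [intervalIntegral.integral_of_le H0.le]
    exact setIntegral_mono_set hφint hae (Set.Ioc_subset_Ioc le_rfl HL).eventuallyLE
  have hJ0 : 0 ≤ ∫ x in (0:ℝ)..H, φ x :=
    intervalIntegral.integral_nonneg H0.le fun x hx => hφnn x hx.1
  have hscale : 2 ^ s * ∫ x in (0:ℝ)..H, φ x ≤ 2 * ∫ x in (0:ℝ)..(H/2), φ x := by
    have e1 : ∫ x in (0:ℝ)..H, φ (x / 2) = 2 * ∫ x in (0:ℝ)..(H/2), φ x := by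
      rw [intervalIntegral.integral_comp_div _ (by norm_num : (2:ℝ) ≠ 0)]; simp
    rw [← e1, ← intervalIntegral.integral_const_mul]
    apply intervalIntegral.integral_mono_on_of_le_Ioo H0.le
    · exact (hii 0 H le_rfl H0.le HL).const_mul _
    · have := (hii 0 (H/2) le_rfl (by linarith) (by linarith)).comp_mul_left (c := 1/2)
      rw [show (0:ℝ) / (1/2) = 0 by norm_num, show H / 2 / (1/2) = H by ring] at this
      convert this using 3
      ring
    · intro x hx
      have hx0 : 0 < x := hx.1
      have h1 := hsub (x/2) (x/2)
      rw [add_halves] at h1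
      simp only [hφ]
      have h2 : (x / 2) ^ (-2 - s) = x ^ (-2 - s) * (4 * 2 ^ s) := by
        rw [Real.div_rpow hx0.le (by norm_num), div_eq_mul_inv, ← Real.rpow_neg (by norm_num),
          show -(-2 - s) = 2 + s by ring, Real.rpow_add (by norm_num)]
        norm_num
      rw [h2]
      have h3 : 0 ≤ x ^ (-2 - s) * 2 ^ s := by positivity
      nlinarith
  have h2s : 2 * s ≤ 2 ^ s := by
    have h1 : (2:ℝ) ^ (s - 1) = 2 ^ s / 2 := by
      rw [Real.rpow_sub (by norm_num), Real.rpow_one]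
    have h2 : s ≤ (2:ℝ) ^ (s - 1) := by
      rw [Real.rpow_def_of_pos (by norm_num)]
      have := Real.add_one_le_exp (Real.log 2 * (s - 1))
      have hlog : Real.log 2 ≤ 1 := by linarith [Real.log_two_lt_d9]
      nlinarith
    linarith
  have hD : ∫ x in (H/2)..H, φ x ≤ (1 - s) * E := by
    have hadd := intervalIntegral.integral_add_adjacent_intervals
      (hii 0 (H/2) le_rfl (by linarith) (by linarith)) (hii (H/2) H (by linarith) (by linarith) HL)
    nlinarith
  have hΩH : ∫ x in (H/2)..H, Ω x ≤ H ^ (2 + s) * ((1 - s) * E) := by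
    calc ∫ x in (H/2)..H, Ω x ≤ ∫ x in (H/2)..H, H ^ (2 + s) * φ x := by
          apply intervalIntegral.integral_mono_on (by linarith) (hc.intervalIntegrable _ _)
          · exact (hii (H/2) H (by linarith) (by linarith) HL).const_mul _
          · intro x hx
            have hx0 : 0 < x := by linarith [hx.1]
            have h1 : x ^ (2 + s) * x ^ (-2 - s) = 1 := by
              rw [← Real.rpow_add hx0]; simp
            have h2 : x ^ (2 + s) ≤ H ^ (2 + s) :=
              Real.rpow_le_rpow hx0.le hx.2 (by linarith)
            calc Ω x = x ^ (2 + s) * φ x := by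
                  simp only [hφ]; rw [mul_left_comm, h1, mul_one]
              _ ≤ H ^ (2 + s) * φ x := mul_le_mul_of_nonneg_right h2 (hφnn x hx0.le)
      _ = H ^ (2 + s) * ∫ x in (H/2)..H, φ x := intervalIntegral.integral_const_mul _ _
      _ ≤ _ := by gcongr
  have hav : H / 2 * Ω h ≤ 4 * ∫ x in (H/2)..H, Ω x := by
    have hr : ∫ x in (H/2)..H, Ω (h - x) = ∫ x in (H/2)..H, Ω x := by
      rw [intervalIntegral.integral_comp_sub_left]
      congr 1 <;> rw [hH] <;> ring
    calc H / 2 * Ω h = ∫ x in (H/2)..H, Ω h := by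
          rw [intervalIntegral.integral_const, smul_eq_mul]; ring
      _ ≤ ∫ x in (H/2)..H, (2 * Ω x + 2 * Ω (h - x)) := by
          apply intervalIntegral.integral_mono_on (by linarith) (by simp)
            (Continuous.intervalIntegrable (by fun_prop) _ _)
          intro x _
          have := hsub x (h - x)
          rwa [add_sub_cancel] at this
      _ = 4 * ∫ x in (H/2)..H, Ω x := by
          rw [intervalIntegral.integral_add (Continuous.intervalIntegrable (by fun_prop) _ _)
            (Continuous.intervalIntegrable (by fun_prop) _ _),
            intervalIntegral.integral_const_mul, intervalIntegral.integral_const_mul, hr]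
          ring
  have hpow : H ^ (2 + s) = H * H ^ (1 + s) := by
    rw [show 2 + s = 1 + (1 + s) by ring, Real.rpow_add H0, Real.rpow_one]
  have h1 : H * Ω h ≤ H * (8 * (1 - s) * E * H ^ (1 + s)) := by
    rw [hpow] at hΩH
    nlinarith
  have h2 := le_of_mul_le_mul_left h1 H0
  refine h2.trans ?_
  have h3 : H ^ (1 + s) ≤ h ^ (1 + s) := Real.rpow_le_rpow H0.le (by linarith) (by linarith)
  have h4 : 0 ≤ 8 * (1 - s) * E := by
    have : 0 ≤ 1 - s := by linarith
    positivity
  gcongr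

lemma lintegral_periodic_shift (g : ℝ → ℝ≥0∞) (L : ℝ) (hL : 0 < L) (hg : Function.Periodic g L)
    (x : ℝ) : ∫⁻ h in Set.Ioc 0 L, g (x + h) = ∫⁻ u in Set.Ioc 0 L, g u := by
  have h1 : ∫⁻ h in Set.Ioc 0 L, g (x + h) = ∫⁻ u in Set.Ioc x (x + L), g u := by
    have := (measurePreserving_add_left volume x).setLIntegral_comp_preimage_emb
      (measurableEmbedding_addLeft x) g (Set.Ioc x (x + L))
    rw [← this]
    simp
  rw [h1]
  have : VAddInvariantMeasure (AddSubgroup.zmultiples L) ℝ volume :=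
    ⟨fun c s _ => measure_preimage_add _ _ _⟩
  have h2 := IsAddFundamentalDomain.setLIntegral_eq (G := AddSubgroup.zmultiples L)
    (isAddFundamentalDomain_Ioc hL x) (isAddFundamentalDomain_Ioc hL 0) g hg.map_vadd_zmultiples
  rw [h2, zero_add]

lemma omega_energy {C₀ s L : ℝ} {γ : ℝ → E3} (hs : s ∈ Set.Ioo (1/2 : ℝ) 1)
    (H : CurveHyp C₀ s L γ) :
    ∫⁻ h in Set.Ioc 0 L, ENNReal.ofReal
      ((∫ x in (0:ℝ)..L, ‖nu γ (x + h) - nu γ x‖ ^ 2) * h ^ (-2 - s))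
      ≤ ENNReal.ofReal (16 * (C₀ * L)) := by
  obtain ⟨hL, hLC, hcd, hper, h1, h2, hinj, hen⟩ := H
  have hdiff : Differentiable ℝ γ := hcd.differentiable (by norm_num)
  have hf := continuous_nu hcd
  have hfper := periodic_nu hper
  set f := nu γ with hfdef
  have e1 : ∀ h ∈ Set.Ioc 0 L, ENNReal.ofReal
      ((∫ x in (0:ℝ)..L, ‖f (x + h) - f x‖ ^ 2) * h ^ (-2 - s)) =
      ∫⁻ x in Set.Ioc 0 L, ENNReal.ofReal (‖f (x + h) - f x‖ ^ 2 * h ^ (-2 - s)) := by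
    intro h hh
    rw [← intervalIntegral.integral_mul_const, intervalIntegral.integral_of_le hL.le]
    apply ofReal_integral_eq_lintegral_ofReal
    · have : Continuous fun x => ‖f (x + h) - f x‖ ^ 2 * h ^ (-2 - s) := by fun_prop
      exact (intervalIntegrable_iff_integrableOn_Ioc_of_le hL.le).1 (this.intervalIntegrable 0 L)
    · exact Filter.Eventually.of_forall fun x =>
        mul_nonneg (by positivity) (Real.rpow_nonneg hh.1.le _)
  rw [setLIntegral_congr_fun measurableSet_Ioc e1]
  rw [lintegral_lintegral_swap]
  · rw [← restrict_Ioc_eq_restrict_Icc] at hen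
    calc ∫⁻ x in Set.Ioc 0 L, ∫⁻ h in Set.Ioc 0 L,
          ENNReal.ofReal (‖f (x + h) - f x‖ ^ 2 * h ^ (-2 - s))
        ≤ ∫⁻ x in Set.Ioc 0 L, 16 * ∫⁻ u in Set.Ioc 0 L,
          ENNReal.ofReal (‖f x - f u‖ ^ 2) * kernelK s (γ x) (γ u) := by
          apply lintegral_mono
          intro x
          simp only
          set g : ℝ → ℝ≥0∞ := fun u => ENNReal.ofReal (‖f x - f u‖ ^ 2) * kernelK s (γ x) (γ u)
            with hg
          have hgper : Function.Periodic g L := by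
            intro u
            simp only [hg, hper u, hfper u]
          rw [← lintegral_periodic_shift g L hL hgper x, ← lintegral_const_mul' _ _ (by norm_num)]
          apply setLIntegral_mono' measurableSet_Ioc
          intro h hh
          have hk := kernel_lower s hs (γ x) (γ (x + h)) (h1 _) (h1 _) h hh.1 (by
            have := norm_curve_sub hdiff h2 x (x + h)
            simpa [abs_of_pos hh.1] using this)
          simp only [hg]
          calc ENNReal.ofReal (‖f (x + h) - f x‖ ^ 2 * h ^ (-2 - s))
              = 16 * (ENNReal.ofReal (‖f x - f (x + h)‖ ^ 2) *
                ENNReal.ofReal (h ^ (-2 - s) / 16)) := by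
                rw [← ENNReal.ofReal_mul (by positivity), norm_sub_rev,
                  show (16 : ℝ≥0∞) = ENNReal.ofReal 16 by simp,
                  ← ENNReal.ofReal_mul (by norm_num)]
                congr 1; ring
            _ ≤ _ := by gcongr
      _ = 16 * ∫⁻ x in Set.Ioc 0 L, ∫⁻ u in Set.Ioc 0 L,
          ENNReal.ofReal (‖f x - f u‖ ^ 2) * kernelK s (γ x) (γ u) :=
          lintegral_const_mul' _ _ (by norm_num)
      _ ≤ 16 * ENNReal.ofReal (C₀ * L) := by gcongr
      _ = _ := by
          rw [ENNReal.ofReal_mul (by norm_num : (0:ℝ) ≤ 16)]; simp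
  · apply Measurable.aemeasurable
    have := hf.measurable
    unfold Function.uncurry
    fun_prop

lemma holder_nu {C₀ s L : ℝ} {γ : ℝ → E3} (hC₀ : 0 < C₀) (hs : s ∈ Set.Ioo (1/2 : ℝ) 1)
    (H : CurveHyp C₀ s L γ) (x h : ℝ) (h0 : 0 < h) (hhL : h ≤ L) :
    ‖nu γ (x + h) - nu γ x‖ ≤
      9 * (Real.sqrt (128 * C₀ ^ 2 * (1 + C₀)) * (1 - s) ^ (1/2 : ℝ)) * h ^ (1/4 : ℝ) := by
  have hen := omega_energy hs H
  obtain ⟨hL, hLC, hcd, hper, h1, h2, hinj, -⟩ := H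
  have hf := continuous_nu hcd
  have hfper := periodic_nu hper
  set f := nu γ with hfdef
  have hs1 := hs.1
  have hs2 := hs.2
  have h1s : 0 < 1 - s := by linarith
  have hshift : ∀ a h : ℝ, ∫ x in a..(a + L), ‖f (x + h) - f x‖ ^ 2 =
      ∫ x in (0:ℝ)..L, ‖f (x + h) - f x‖ ^ 2 := by
    intro a h
    have hp : Function.Periodic (fun x => ‖f (x + h) - f x‖ ^ 2) L := by
      intro x
      simp only [hfper x, show x + L + h = x + h + L by ring, hfper (x + h)]
    have := hp.intervalIntegral_add_eq a 0
    rwa [zero_add] at this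
  have key : ∀ h, 0 < h → h ≤ L → ∫ x in (0:ℝ)..L, ‖f (x + h) - f x‖ ^ 2 ≤
      8 * (1 - s) * (16 * (C₀ * L)) * h ^ (1 + s) := by
    intro h h0 hhL
    refine omega_abstract (fun h => ∫ x in (0:ℝ)..L, ‖f (x + h) - f x‖ ^ 2) ?_ ?_ ?_ s L _ hs
      (by positivity) hen h h0 hhL
    · apply intervalIntegral.continuous_parametric_intervalIntegral_of_continuous'
      unfold Function.uncurry
      fun_prop
    · intro h
      exact intervalIntegral.integral_nonneg hL.le fun x _ => by positivity
    · intro h k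
      have e1 : ∫ x in (0:ℝ)..L, ‖f (x + k + h) - f (x + k)‖ ^ 2 =
          ∫ x in (0:ℝ)..L, ‖f (x + h) - f x‖ ^ 2 := by
        rw [intervalIntegral.integral_comp_add_right (fun x => ‖f (x + h) - f x‖ ^ 2) k,
          zero_add, add_comm L k, hshift]
      rw [← e1, ← intervalIntegral.integral_const_mul, ← intervalIntegral.integral_const_mul,
        ← intervalIntegral.integral_add (Continuous.intervalIntegrable (by fun_prop) _ _)
          (Continuous.intervalIntegrable (by fun_prop) _ _)]
      apply intervalIntegral.integral_mono_on hL.le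
        (Continuous.intervalIntegrable (by fun_prop) _ _)
        (Continuous.intervalIntegrable (by fun_prop) _ _)
      intro x _
      have ht : ‖f (x + (h + k)) - f x‖ ≤ ‖f (x + k + h) - f (x + k)‖ + ‖f (x + k) - f x‖ := by
        rw [show x + (h + k) = x + k + h by ring]
        exact norm_sub_le_norm_sub_add_norm_sub ..
      have hn := norm_nonneg (f (x + (h + k)) - f x)
      nlinarith [sq_nonneg (‖f (x + k + h) - f (x + k)‖ - ‖f (x + k) - f x‖)]
  set K := 128 * C₀ ^ 2 * (1 + C₀) with hK
  have hK0 : 0 < K := by positivity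
  refine morrey f hf L _ (by positivity) ?_ x h h0 hhL
  intro x h h0 hhL
  have hB2 : (Real.sqrt K * (1 - s) ^ (1/2 : ℝ)) ^ 2 = K * (1 - s) := by
    rw [mul_pow, Real.sq_sqrt hK0.le, ← Real.sqrt_eq_rpow, Real.sq_sqrt h1s.le]
  rw [hB2]
  calc ∫ u in x..(x + h), ‖f (u + h) - f u‖ ^ 2
      ≤ ∫ u in x..(x + L), ‖f (u + h) - f u‖ ^ 2 := by
        apply intervalIntegral.integral_mono_interval le_rfl (by linarith) (by linarith)
        · exact Filter.Eventually.of_forall fun u => by simp only [Pi.zero_apply]; positivity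
        · exact Continuous.intervalIntegrable (by fun_prop) _ _
    _ ≤ 8 * (1 - s) * (16 * (C₀ * L)) * h ^ (1 + s) := by rw [hshift]; exact key h h0 hhL
    _ = 128 * C₀ * L * (1 - s) * (h ^ (s - 1/2) * h ^ (3/2 : ℝ)) := by
        rw [← Real.rpow_add h0, show s - 1/2 + 3/2 = 1 + s by ring]; ring
    _ ≤ 128 * C₀ * C₀ * (1 - s) * ((1 + C₀) * h ^ (3/2 : ℝ)) := by
        have : h ^ (s - 1/2) ≤ 1 + C₀ := by
          calc h ^ (s - 1/2) ≤ (1 + C₀) ^ (s - 1/2) :=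
                Real.rpow_le_rpow h0.le (by linarith) (by linarith)
            _ ≤ (1 + C₀) ^ (1:ℝ) :=
                Real.rpow_le_rpow_of_exponent_le (by linarith) (by linarith)
            _ = 1 + C₀ := Real.rpow_one _
        gcongr
    _ = K * (1 - s) * h ^ (3/2 : ℝ) := by rw [hK]; ring

lemma gram_identity (a u v : E3) : ⟪a, cross u v⟫ ^ 2 =
    ⟪a, a⟫ * ⟪u, u⟫ * ⟪v, v⟫ + 2 * ⟪a, u⟫ * ⟪u, v⟫ * ⟪a, v⟫ - ⟪a, a⟫ * ⟪u, v⟫ ^ 2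
      - ⟪u, u⟫ * ⟪a, v⟫ ^ 2 - ⟪v, v⟫ * ⟪a, u⟫ ^ 2 := by
  simp only [inner_E3]; simp [cross]; ring

lemma parseval3 (a u v : E3) (hu : ‖u‖ = 1) (hv : ‖v‖ = 1) (huv : ⟪u, v⟫ = 0) :
    ⟪a, u⟫ ^ 2 + ⟪a, v⟫ ^ 2 + ⟪a, cross u v⟫ ^ 2 = ‖a‖ ^ 2 := by
  rw [gram_identity, huv, real_inner_self_eq_norm_sq, real_inner_self_eq_norm_sq,
    real_inner_self_eq_norm_sq, hu, hv]
  ring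

lemma not_inj_aux {γ : ℝ → E3} {L : ℝ} (hL : 0 < L) (hper : Function.Periodic γ L)
    (hinj : Set.InjOn γ (Set.Ico 0 L)) (t u : ℝ) (htu : t < u) (hut : u < t + L)
    (h : γ t = γ u) : False := by
  set m : ℤ := ⌊t / L⌋ with hm
  have h1 : (m : ℝ) * L ≤ t := by
    have := Int.floor_le (t / L)
    rwa [le_div_iff₀ hL] at this
  have h2 : t < (m + 1 : ℝ) * L := by
    have := Int.lt_floor_add_one (t / L)
    rwa [div_lt_iff₀ hL] at this
  have e1 : γ (t - m * L) = γ t := hper.sub_int_mul_eq m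
  have m1 : t - m * L ∈ Set.Ico 0 L := ⟨by linarith, by linarith⟩
  rcases lt_or_ge (u - m * L) L with h3 | h3
  · have e2 : γ (u - m * L) = γ u := hper.sub_int_mul_eq m
    have := hinj m1 (⟨by linarith, h3⟩ : u - m * L ∈ Set.Ico 0 L) (by rw [e1, e2, h])
    linarith
  · have e2 : γ (u - (m + 1 : ℤ) * L) = γ u := hper.sub_int_mul_eq (m + 1)
    push_cast at e2
    have := hinj m1 (⟨by linarith, by linarith⟩ : u - (m + 1 : ℝ) * L ∈ Set.Ico 0 L)
      (by rw [e1, e2, h])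
    linarith

lemma length_close {L δ : ℝ} {γ : ℝ → E3} (hL : 0 < L) (hcd : ContDiff ℝ 2 γ)
    (hper : Function.Periodic γ L) (h1 : ∀ t, ‖γ t‖ = 1) (h2 : ∀ t, ‖deriv γ t‖ = 1)
    (hinj : Set.InjOn γ (Set.Ico 0 L)) (hδ : δ ^ 2 ≤ 1/2) (hδ0 : 0 ≤ δ)
    (hnu : ∀ t, ‖nu γ t - nu γ 0‖ ≤ δ) : |L - 2 * Real.pi| ≤ 7 * δ ^ 2 := by
  have hdiff : Differentiable ℝ γ := hcd.differentiable (by norm_num)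
  have hcγ : Continuous γ := hcd.continuous
  have hcγ' : Continuous (deriv γ) := hcd.continuous_deriv (by norm_num)
  have horth := inner_deriv_zero γ hdiff h1
  have hnn := norm_nu γ hdiff h1 h2
  set u1 := γ 0 with hu1
  set u2 := deriv γ 0 with hu2
  set e := nu γ 0 with he
  have he' : e = cross u1 u2 := rfl
  set z : ℝ → ℝ := fun t => ⟪γ t, e⟫ with hz
  have hcz : Continuous z := by fun_prop
  have hzper : Function.Periodic z L := fun t => by simp only [hz, hper t]
  have hpars : ∀ t, ⟪γ t, u1⟫ ^ 2 + ⟪γ t, u2⟫ ^ 2 + z t ^ 2 = 1 := by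
    intro t
    have := parseval3 (γ t) u1 u2 (h1 0) (h2 0) (horth 0)
    rw [h1 t] at this
    rw [← he'] at this
    simpa using this
  have hzle : ∀ t, z t ^ 2 ≤ δ ^ 2 := by
    intro t
    have e1 : z t = ⟪γ t, e - nu γ t⟫ := by
      rw [inner_sub_right]
      have : ⟪γ t, nu γ t⟫ = 0 := inner_cross_self _ _
      rw [this, sub_zero]
    have e2 : |z t| ≤ δ := by
      rw [e1]
      refine (abs_real_inner_le_norm _ _).trans ?_
      rw [h1 t, one_mul, norm_sub_rev]
      exact hnu t
    rw [← sq_abs]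
    gcongr
  have hnue : ∀ t, 1 - δ ^ 2 / 2 ≤ ⟪nu γ t, e⟫ ∧ ⟪nu γ t, e⟫ ≤ 1 := by
    intro t
    have e1 := norm_sub_sq_real (nu γ t) e
    have e2 : ‖nu γ t - e‖ ^ 2 ≤ δ ^ 2 := by gcongr; exact hnu t
    rw [hnn t, hnn 0] at e1
    constructor <;> nlinarith [sq_nonneg ‖nu γ t - e‖]
  set w : ℝ → ℂ := fun t => (⟪γ t, u1⟫ : ℝ) + (⟪γ t, u2⟫ : ℝ) * Complex.I with hw
  set w' : ℝ → ℂ := fun t => (⟪deriv γ t, u1⟫ : ℝ) + (⟪deriv γ t, u2⟫ : ℝ) * Complex.I with hw'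
  have hnormsq : ∀ t, Complex.normSq (w t) = 1 - z t ^ 2 := by
    intro t
    have := hpars t
    simp only [hw, Complex.normSq_add_mul_I]
    linarith
  have hw0 : ∀ t, w t ≠ 0 := by
    intro t h
    have h3 := hnormsq t
    rw [h] at h3
    have := hzle t
    simp at h3
    linarith
  have hcw : Continuous w := by fun_prop
  have hcw' : Continuous w' := by fun_prop
  have hdw : ∀ t, HasDerivAt w (w' t) t := by
    intro t
    have hd := (hdiff t).hasDerivAt
    have d1 : HasDerivAt (fun t => ⟪γ t, u1⟫) ⟪deriv γ t, u1⟫ t := by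
      simpa using hd.inner ℝ (hasDerivAt_const t u1)
    have d2 : HasDerivAt (fun t => ⟪γ t, u2⟫) ⟪deriv γ t, u2⟫ t := by
      simpa using hd.inner ℝ (hasDerivAt_const t u2)
    exact d1.ofReal_comp.add (d2.ofReal_comp.mul_const _)
  have hcq : Continuous (fun t => w' t / w t) := hcw'.div hcw hw0
  set l : ℝ → ℂ := fun t => ∫ x in (0:ℝ)..t, w' x / w x with hl
  have hdl : ∀ t, HasDerivAt l (w' t / w t) t := fun t =>
    intervalIntegral.integral_hasDerivAt_right (hcq.intervalIntegrable _ _)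
      (hcq.stronglyMeasurableAtFilter _ _) hcq.continuousAt
  have hl0 : l 0 = 0 := by simp [hl]
  have hw1 : w 0 = 1 := by
    have a1 : ⟪u1, u1⟫ = 1 := by rw [real_inner_self_eq_norm_sq, h1]; norm_num
    have a2 : ⟪u1, u2⟫ = 0 := horth 0
    simp only [hw]
    rw [← hu1, a1, a2]; simp
  have hexp : ∀ t, w t = Complex.exp (l t) := by
    have hd : ∀ t, HasDerivAt (fun t => w t * Complex.exp (-l t)) 0 t := by
      intro t
      have := (hdw t).mul ((hdl t).neg.cexp)
      have e0 : w' t * Complex.exp ((-l) t) + w t * (Complex.exp ((-l) t) * -(w' t / w t)) = 0 := by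
        have e1 : w t * (w' t / w t) = w' t := by
          have := hw0 t
          field_simp
        linear_combination (-Complex.exp ((-l) t)) * e1
      rw [e0] at this
      exact this
    intro t
    have hc := is_const_of_deriv_eq_zero (fun t => (hd t).differentiableAt)
      (fun t => (hd t).deriv) t 0
    simp only [hl0, hw1, neg_zero, Complex.exp_zero, mul_one] at hc
    rw [Complex.exp_neg] at hc
    have := Complex.exp_ne_zero (l t)
    field_simp at hc
    exact hc
  set θ : ℝ → ℝ := fun t => (l t).im with hθ
  set θ' : ℝ → ℝ := fun t => ⟪nu γ t, e⟫ / (1 - z t ^ 2) with hθ'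
  have hdθ : ∀ t, HasDerivAt θ (θ' t) t := by
    intro t
    have hd := Complex.imCLM.hasFDerivAt.comp_hasDerivAt t (hdl t)
    have hv : Complex.imCLM (w' t / w t) = θ' t := by
      simp only [hθ', Complex.imCLM_apply, Complex.div_im, hnormsq]
      rw [he', nu, inner_cross_cross]
      simp [hw, hw']
      ring
    rw [hv] at hd
    exact hd
  have hθ'lo : ∀ t, 1 - δ ^ 2 / 2 ≤ θ' t := by
    intro t
    have a1 := (hnue t).1
    have a2 := hzle t
    have a3 := sq_nonneg (z t)
    simp only [hθ']
    rw [le_div_iff₀ (by linarith)]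
    nlinarith
  have hθ'hi : ∀ t, θ' t * (1 - δ ^ 2) ≤ 1 := by
    intro t
    have a1 := (hnue t).2
    have a2 := hzle t
    have a4 : θ' t * (1 - z t ^ 2) = ⟪nu γ t, e⟫ := by
      simp only [hθ']
      rw [div_mul_cancel₀]
      linarith
    have := hθ'lo t
    nlinarith
  have hcθ : Continuous θ := continuous_iff_continuousAt.2 fun t => (hdθ t).continuousAt
  have hmono : Monotone (fun t => θ t - t / 2) := by
    have hd : ∀ t, HasDerivAt (fun t => θ t - t / 2) (θ' t - 1 / 2) t := fun t =>
      (hdθ t).sub ((hasDerivAt_id t).div_const 2)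
    apply monotone_of_deriv_nonneg (fun t => (hd t).differentiableAt)
    intro t
    rw [(hd t).deriv]
    linarith [hθ'lo t]
  have hstrict : StrictMono θ := by
    intro a b hab
    have := hmono hab.le
    simp only at this
    linarith
  have hθ0 : θ 0 = 0 := by simp [hθ, hl0]
  have hsurj : Function.Surjective θ := by
    apply hcθ.surjective
    · apply Filter.tendsto_atTop_mono' _ _
        (Filter.tendsto_id.atTop_div_const (by norm_num : (0:ℝ) < 2))
      filter_upwards [Filter.eventually_ge_atTop 0] with t ht
      have := hmono ht
      simp only [hθ0] at this
      simp only [id]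
      linarith
    · apply Filter.tendsto_atBot_mono' _ _
        (Filter.tendsto_id.atBot_div_const (by norm_num : (0:ℝ) < 2))
      filter_upwards [Filter.eventually_le_atBot 0] with t ht
      have := hmono ht
      simp only [hθ0] at this
      simp only [id]
      linarith
  have hqper : Function.Periodic (fun t => w' t / w t) L := by
    intro t
    simp only [hw, hw', hper t, periodic_deriv hper t]
  have hθadd : ∀ t, θ (t + L) = θ t + θ L := by
    intro t
    have := hqper.intervalIntegral_add_eq t 0
    have h3 := intervalIntegral.integral_add_adjacent_intervals
      (hcq.intervalIntegrable (μ := volume) 0 t) (hcq.intervalIntegrable t (t + L))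
    rw [zero_add] at this
    rw [this] at h3
    simp only [hθ, hl]
    rw [← h3, Complex.add_im]
  have hθL : 0 < θ L := by
    have := hstrict hL
    rwa [hθ0] at this
  obtain ⟨n, hn⟩ : ∃ n : ℤ, θ L = n * (2 * Real.pi) := by
    have : Complex.exp (l L) = 1 := by
      rw [← hexp, ← hw1]
      have := hper 0
      rw [zero_add] at this
      simp only [hw, this]
    obtain ⟨n, hn⟩ := Complex.exp_eq_one_iff.1 this
    refine ⟨n, ?_⟩
    simp only [hθ, hn]
    simp
  have hpi := Real.pi_pos
  have hn1 : 1 ≤ n := by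
    by_contra hc
    have : n ≤ 0 := by omega
    have : (n : ℝ) ≤ 0 := by exact_mod_cast this
    nlinarith
  have hn2 : n = 1 := by
    by_contra hne
    have hn2 : 2 ≤ n := by omega
    have hn2' : (2 : ℝ) ≤ n := by exact_mod_cast hn2
    set Θ := StrictMono.orderIsoOfSurjective θ hstrict hsurj with hΘ
    set φ : ℝ → ℝ := fun a => Θ.symm a with hφ
    have hcφ : Continuous φ := Θ.symm.continuous
    have hθφ : ∀ a, θ (φ a) = a := fun a => Θ.apply_symm_apply a
    have hφθ : ∀ t, φ (θ t) = t := fun t => Θ.symm_apply_apply t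
    have hφmono : StrictMono φ := Θ.symm.strictMono
    obtain ⟨t0, -, hmax⟩ := isCompact_Icc.exists_isMaxOn (Set.nonempty_Icc.2 hL.le)
      hcz.continuousOn
    have hmax' : ∀ t, z t ≤ z t0 := by
      intro t
      obtain ⟨y, hy, hty⟩ := hzper.exists_mem_Ico₀ hL t
      rw [hty]
      exact hmax (Set.Ico_subset_Icc_self hy)
    set a0 := θ t0 with ha0
    have hIVT := intermediate_value_Icc' (f := fun a => z (φ (a + 2 * Real.pi)) - z (φ a))
      (by linarith : a0 - 2 * Real.pi ≤ a0) (Continuous.continuousOn (by fun_prop))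
    obtain ⟨a, -, ha⟩ := hIVT (show (0:ℝ) ∈ _ by
      constructor
      · simp only [ha0, hφθ]
        linarith [hmax' (φ (θ t0 + 2 * Real.pi))]
      · simp only [sub_add_cancel, ha0, hφθ]
        linarith [hmax' (φ (θ t0 - 2 * Real.pi))])
    simp only at ha
    set t := φ a with ht
    set u := φ (a + 2 * Real.pi) with hu
    have hzeq : z t = z u := by linarith
    have htu : t < u := hφmono (by linarith)
    have hut : u < t + L := by
      rw [← hstrict.lt_iff_lt, hθadd, hn, ht, hu, hθφ, hθφ]
      nlinarith
    have him : (l u).im = (l t).im + 2 * Real.pi := by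
      change θ u = θ t + _
      rw [ht, hu, hθφ, hθφ]
    have hre : (l u).re = (l t).re := by
      have e1 : ‖w t‖ = ‖w u‖ := by
        have a1 := hnormsq t
        rw [hzeq, ← hnormsq u, Complex.normSq_eq_norm_sq, Complex.normSq_eq_norm_sq] at a1
        exact (sq_eq_sq₀ (norm_nonneg _) (norm_nonneg _)).1 a1
      rw [hexp, hexp, Complex.norm_exp, Complex.norm_exp] at e1
      exact (Real.exp_injective e1).symm
    have hweq : w u = w t := by
      rw [hexp, hexp]
      have : l u = l t + 2 * Real.pi * Complex.I := by
        apply Complex.ext <;> simp [him, hre]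
      rw [this, Complex.exp_periodic]
    have hγ : γ t = γ u := by
      have c1 : ⟪γ u, u1⟫ = ⟪γ t, u1⟫ := by
        have := congrArg Complex.re hweq
        simpa [hw] using this
      have c2 : ⟪γ u, u2⟫ = ⟪γ t, u2⟫ := by
        have := congrArg Complex.im hweq
        simpa [hw] using this
      have c3 : ⟪γ t, e⟫ = ⟪γ u, e⟫ := hzeq
      have := parseval3 (γ t - γ u) u1 u2 (h1 0) (h2 0) (horth 0)
      rw [← he', inner_sub_left, inner_sub_left, inner_sub_left, c1, c2, c3] at this
      simp only [sub_self] at this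
      have h0 : ‖γ t - γ u‖ = 0 := by
        have : ‖γ t - γ u‖ ^ 2 = 0 := by linarith
        exact pow_eq_zero_iff (two_ne_zero) |>.1 this
      exact sub_eq_zero.1 (norm_eq_zero.1 h0)
    exact not_inj_aux hL hper hinj t u htu hut hγ
  have hθL2 : θ L = 2 * Real.pi := by rw [hn, hn2]; simp
  obtain ⟨c, -, hcs⟩ := exists_hasDerivAt_eq_slope θ θ' hL hcθ.continuousOn (fun x _ => hdθ x)
  rw [hθL2, hθ0, sub_zero, sub_zero, eq_div_iff hL.ne'] at hcs
  have b1 := hθ'lo c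
  have b2 := hθ'hi c
  have b3 : (1 - δ ^ 2 / 2) * L ≤ 2 * Real.pi := by rw [← hcs]; gcongr
  have b4 : 2 * Real.pi * (1 - δ ^ 2) ≤ L := by
    rw [← hcs]
    calc θ' c * L * (1 - δ ^ 2) = (θ' c * (1 - δ ^ 2)) * L := by ring
      _ ≤ 1 * L := by gcongr
      _ = L := one_mul L
  have hp2 : Real.pi < 3.15 := Real.pi_lt_d2
  have hδ2 := sq_nonneg δ
  rw [abs_le]
  constructor
  · nlinarith
  · have hL9 : L ≤ 9 := by nlinarith
    nlinarith

lemma nu_close {C₀ : ℝ} (hC₀ : 0 < C₀) : ∃ C : ℝ, 0 < C ∧ ∀ s ∈ Set.Ioo (1/2 : ℝ) 1, ∀ L : ℝ,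
      ∀ γ₀ : ℝ → E3, CurveHyp C₀ s L γ₀ →
        (∀ t : ℝ, ‖nu γ₀ t - nu γ₀ 0‖ ≤ C * (1 - s) ^ (1/2 : ℝ)) ∧
        (∀ t ∈ Set.Icc (0:ℝ) L, ∀ u ∈ Set.Icc (0:ℝ) L,
          ‖nu γ₀ t - nu γ₀ u‖ ≤ C * (1 - s) ^ (1/2 : ℝ) * |t - u| ^ (1/4 : ℝ)) := by
  set K : ℝ := 9 * Real.sqrt (128 * C₀ ^ 2 * (1 + C₀)) with hK
  have hK0 : 0 < K := by positivity
  refine ⟨K * (1 + C₀), by positivity, ?_⟩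
  intro s hs L γ H
  have hhol := fun x h => holder_nu hC₀ hs H x h
  obtain ⟨hL, hLC, hcd, hper, -, -, -, -⟩ := H
  have h1s : 0 < 1 - s := by linarith [hs.2]
  have hS : 0 < (1 - s) ^ (1/2 : ℝ) := by positivity
  have hh : ∀ x h, 0 < h → h ≤ L →
      ‖nu γ (x + h) - nu γ x‖ ≤ K * (1 - s) ^ (1/2 : ℝ) * h ^ (1/4 : ℝ) := by
    intro x h h0 hhL
    refine (hhol x h h0 hhL).trans (le_of_eq ?_)
    rw [hK]; ring
  constructor
  · intro t
    obtain ⟨y, hy, hty⟩ := (periodic_nu hper).exists_mem_Ico₀ hL t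
    rw [hty]
    rcases hy.1.eq_or_lt with h0 | h0
    · rw [← h0, sub_self, norm_zero]; positivity
    · have h1 := hh 0 y h0 hy.2.le
      rw [zero_add] at h1
      refine h1.trans ?_
      have : y ^ (1/4 : ℝ) ≤ 1 + C₀ := by
        calc y ^ (1/4 : ℝ) ≤ (1 + C₀) ^ (1/4 : ℝ) :=
              Real.rpow_le_rpow h0.le (by linarith [hy.2]) (by norm_num)
          _ ≤ (1 + C₀) ^ (1:ℝ) :=
              Real.rpow_le_rpow_of_exponent_le (by linarith) (by norm_num)
          _ = 1 + C₀ := Real.rpow_one _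
      calc K * (1 - s) ^ (1/2 : ℝ) * y ^ (1/4 : ℝ) ≤ K * (1 - s) ^ (1/2 : ℝ) * (1 + C₀) := by
            gcongr
        _ = _ := by ring
  · have main : ∀ t ∈ Set.Icc (0:ℝ) L, ∀ u ∈ Set.Icc (0:ℝ) L, u ≤ t →
        ‖nu γ t - nu γ u‖ ≤ K * (1 + C₀) * (1 - s) ^ (1/2 : ℝ) * |t - u| ^ (1/4 : ℝ) := by
      intro t ht u hu hut
      rcases hut.eq_or_lt with h0 | h0
      · rw [h0, sub_self, norm_zero]; positivity
      · have h1 := hh u (t - u) (by linarith) (by linarith [ht.2, hu.1])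
        rw [add_sub_cancel] at h1
        rw [abs_of_pos (by linarith)]
        refine h1.trans ?_
        have : 0 < t - u := by linarith
        gcongr
        nlinarith
    intro t ht u hu
    rcases le_total u t with h | h
    · exact main t ht u hu h
    · rw [norm_sub_rev, abs_sub_comm]
      exact main u hu t ht h


/-- for every `C₀ > 0` there is `C = C(C₀)` such that for all `s ∈ (1/2,1)`,
any curve satisfying `CurveHyp C₀ s L γ₀` has its normal `(C(1−s)^{1/2})`-close in `C^{1/4}`
to a constant unit vector `e`; moreover `L → 2π` as `s ↑ 1`, uniformly over such curves. -/
theorem curve_close_to_great_circle (C₀ : ℝ) (hC₀ : 0 < C₀) :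
    (∃ C : ℝ, 0 < C ∧ ∀ s ∈ Set.Ioo (1/2 : ℝ) 1, ∀ L : ℝ, ∀ γ₀ : ℝ → E3,
      CurveHyp C₀ s L γ₀ →
      ∃ e : E3, ‖e‖ = 1 ∧
        (∀ t : ℝ, ‖nu γ₀ t - e‖ ≤ C * (1 - s) ^ (1/2 : ℝ)) ∧
        (∀ t ∈ Set.Icc (0:ℝ) L, ∀ u ∈ Set.Icc (0:ℝ) L,
          ‖nu γ₀ t - nu γ₀ u‖ ≤ C * (1 - s) ^ (1/2 : ℝ) * |t - u| ^ (1/4 : ℝ))) ∧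
    (∀ ε : ℝ, 0 < ε → ∃ sStar ∈ Set.Ioo (1/2 : ℝ) 1,
      ∀ s ∈ Set.Ioo sStar 1, ∀ L : ℝ, ∀ γ₀ : ℝ → E3,
        CurveHyp C₀ s L γ₀ → |L - 2 * Real.pi| ≤ ε) := by
  obtain ⟨C, hC, hmain⟩ := nu_close hC₀
  refine ⟨⟨C, hC, ?_⟩, ?_⟩
  · intro s hs L γ H
    obtain ⟨a1, a2⟩ := hmain s hs L γ H
    obtain ⟨-, -, hcd, -, h1, h2, -, -⟩ := H
    exact ⟨nu γ 0, norm_nu γ (hcd.differentiable (by norm_num)) h1 h2 0, a1, a2⟩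
  · intro ε hε
    set η : ℝ := min (1/4) (min (1 / (2 * C ^ 2)) (ε / (7 * C ^ 2))) with hη
    have hη0 : 0 < η := by positivity
    have hη1 : η ≤ 1/4 := min_le_left _ _
    have hη2 : η ≤ 1 / (2 * C ^ 2) := (min_le_right _ _).trans (min_le_left _ _)
    have hη3 : η ≤ ε / (7 * C ^ 2) := (min_le_right _ _).trans (min_le_right _ _)
    refine ⟨1 - η, ⟨by linarith, by linarith⟩, ?_⟩
    intro s hs L γ H
    have hs1 : s ∈ Set.Ioo (1/2 : ℝ) 1 := ⟨by linarith [hs.1], hs.2⟩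
    obtain ⟨a1, -⟩ := hmain s hs1 L γ H
    obtain ⟨hL, -, hcd, hper, h1, h2, hinj, -⟩ := H
    have h1s : 0 < 1 - s := by linarith [hs.2]
    have hsη : 1 - s ≤ η := by linarith [hs.1]
    have hsq : (C * (1 - s) ^ (1/2 : ℝ)) ^ 2 = C ^ 2 * (1 - s) := by
      rw [mul_pow, ← Real.sqrt_eq_rpow, Real.sq_sqrt h1s.le]
    have b1 : (1 - s) * (2 * C ^ 2) ≤ 1 := by
      have := hsη.trans hη2
      rwa [le_div_iff₀ (by positivity)] at this
    have b2 : (1 - s) * (7 * C ^ 2) ≤ ε := by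
      have := hsη.trans hη3
      rwa [le_div_iff₀ (by positivity)] at this
    have := length_close hL hcd hper h1 h2 hinj (by rw [hsq]; linarith) (by positivity) a1
    rw [hsq] at this
    linarith
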